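/- arXiv:math/0212126 — 7 statements merged into one kernel-verified Lean document; each statement's English description precedes it below -/
import Mathlib

section
/- For every planar binary tree t with n+1 leaves, the coordinates (x_1, …, x_n) of the point M(t) ∈ ℝ^n satisfy x_1 + ⋯ + x_n = n(n+1)/2; that is, M(t) lies in the affine hyperplane H. -/
/-- Planar binary trees: a tree is either a single leaf, or the grafting
`node l r = l ∨ r` of two planar binary trees. `Y n` is the set of such trees with
`n + 1` leaves. -/
inductive PBT : Type
  | leaf : PBT
  | node : PBT → PBT → PBT
  deriving DecidableEq

namespace PBT

/-- Number of leaves of a planar binary tree. A tree of `Y n` has `n + 1` leaves. -/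
def leaves : PBT → ℕ
  | leaf => 1
  | node l r => l.leaves + r.leaves

/-- The list of coordinates of Loday's point `M(t)`: `M(|)` is the empty tuple and
`M(t^l ∨ t^r) = (M(t^l), p·q, M(t^r))` where `p`, `q` are the numbers of leaves of
`t^l`, `t^r`.  The `i`-th entry is the weight `a_i · b_i` of the `i`-th internal
vertex of `t`.  A tree `t` belongs to `Y n` iff `t.coords.length = n`. -/
noncomputable def coords : PBT → List ℝ
  | leaf => []
  | node l r => l.coords ++ ((l.leaves : ℝ) * (r.leaves : ℝ)) :: r.coords

/-- The point `M(t) = (a_1 b_1, …, a_n b_n) ∈ ℝ^n`, for `t ∈ Y n`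
(coordinates indexed by `Fin n`, the `i`-th coordinate being `x_{i+1}`). -/
noncomputable def M (n : ℕ) (t : PBT) : Fin n → ℝ := fun i => t.coords.getD i 0

end PBT

namespace PBT

theorem coords_length_add_one (t : PBT) : t.coords.length + 1 = t.leaves := by
  induction t with
  | leaf => rfl
  | node l r ihl ihr =>
    simp only [coords, leaves, List.length_append, List.length_cons]
    omega

theorem coords_sum (t : PBT) :
    t.coords.sum = (t.coords.length : ℝ) * ((t.coords.length : ℝ) + 1) / 2 := by
  induction t with
  | leaf => simp [coords]
  | node l r ihl ihr =>
    simp only [coords, List.sum_append, List.sum_cons, List.length_append, List.length_cons,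
      ihl, ihr, ← coords_length_add_one]
    push_cast
    ring

end PBT

/-- For every planar binary tree `t` with `n+1` leaves, the coordinates of `M(t) ∈ ℝ^n`
satisfy `x_1 + ⋯ + x_n = n(n+1)/2`; that is, `M(t)` lies in the hyperplane `H`. -/
theorem stmt0 (n : ℕ) (t : PBT) (ht : t.coords.length = n) :
    ∑ i : Fin n, PBT.M n t i = (n : ℝ) * ((n : ℝ) + 1) / 2 := by
  subst ht
  rw [← PBT.coords_sum, ← Fin.sum_univ_getElem]
  simp [PBT.M]
end

section
/- For every planar binary tree t ∈ Y_n and every admissible shuffle ω of {1,…,n}, one has p_ω(M(t)) ≥ 0. -/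
/-- The affine function `p_ω` associated to the shuffle `ω` whose first block is
`A` and second block is `Aᶜ` (0-indexed: `A ⊆ Fin n` corresponds to
`{ω_1,…,ω_k} ⊆ {1,…,n}`): with `k = |A|`,
`p_ω(x) = (n−k)·(x_{ω_1}+⋯+x_{ω_k}) − k·(x_{ω_{k+1}}+⋯+x_{ω_n}) + n·k·(n−k)/2`. -/
noncomputable def pShuffle (n : ℕ) (A : Finset (Fin n)) (x : Fin n → ℝ) : ℝ :=
  ((n : ℝ) - A.card) * ∑ i ∈ A, x i - (A.card : ℝ) * ∑ i ∈ Aᶜ, x i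
    + (n : ℝ) * A.card * ((n : ℝ) - A.card) / 2

/-- A shuffle (both blocks nonempty) is admissible when its first block is a set of
consecutive integers `{r+1, …, r+k}`, `1 ≤ k ≤ n−1` (0-indexed: `{r, …, r+k−1}`). -/
def IsAdmissible (n : ℕ) (A : Finset (Fin n)) : Prop :=
  ∃ r k : ℕ, 0 < k ∧ k < n ∧ r + k ≤ n ∧
    A = Finset.univ.filter fun i : Fin n => r ≤ (i : ℕ) ∧ (i : ℕ) < r + k

namespace PBT

theorem leaves_eq_length_coords_add_one (t : PBT) : t.leaves = t.coords.length + 1 := by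
  induction t with
  | leaf => rfl
  | node l r ihl ihr => simp only [leaves, coords, List.length_append, List.length_cons]; omega

theorem coords_node_getD_of_lt (l r : PBT) {i : ℕ} (h : i < l.coords.length) :
    (node l r).coords.getD i 0 = l.coords.getD i 0 :=
  List.getD_append _ _ _ _ h

theorem coords_node_getD_length (l r : PBT) :
    (node l r).coords.getD l.coords.length 0 = (l.leaves : ℝ) * r.leaves := by
  simp [coords]

theorem coords_node_getD_add (l r : PBT) (i : ℕ) :
    (node l r).coords.getD (i + (l.coords.length + 1)) 0 = r.coords.getD i 0 := by
  rw [coords, List.getD_append_right _ _ _ _ (by omega),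
    show i + (l.coords.length + 1) - l.coords.length = i + 1 by omega, List.getD_cons_succ]

theorem sum_Ico_coords_node_left (l r : PBT) (a : ℕ) {b : ℕ} (h : b ≤ l.coords.length) :
    ∑ i ∈ Finset.Ico a b, (node l r).coords.getD i 0 = ∑ i ∈ Finset.Ico a b, l.coords.getD i 0 :=
  Finset.sum_congr rfl fun _ hi =>
    coords_node_getD_of_lt l r ((Finset.mem_Ico.mp hi).2.trans_le h)

theorem sum_Ico_coords_node_right (l r : PBT) (a b : ℕ) :
    ∑ i ∈ Finset.Ico (a + (l.coords.length + 1)) (b + (l.coords.length + 1)),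
      (node l r).coords.getD i 0 = ∑ i ∈ Finset.Ico a b, r.coords.getD i 0 := by
  rw [← Finset.sum_Ico_add']
  exact Finset.sum_congr rfl fun i _ => coords_node_getD_add l r i

/-- A block of coordinates containing the root vertex splits into its left part, the root
coordinate, and its right part. -/
theorem sum_Ico_coords_node_root (l r : PBT) {a : ℕ} (b : ℕ) (ha : a ≤ l.coords.length) :
    ∑ i ∈ Finset.Ico a (b + (l.coords.length + 1)), (node l r).coords.getD i 0 =
      ∑ i ∈ Finset.Ico a l.coords.length, l.coords.getD i 0 + (l.leaves : ℝ) * r.leaves +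
        ∑ i ∈ Finset.Ico 0 b, r.coords.getD i 0 := by
  rw [← Finset.sum_Ico_consecutive _ (by omega : a ≤ l.coords.length + 1) (by omega),
    Finset.sum_Ico_succ_top ha, sum_Ico_coords_node_left l r a le_rfl, coords_node_getD_length,
    ← sum_Ico_coords_node_right l r 0 b, Nat.zero_add]

theorem sum_Ico_coords_eq (t : PBT) :
    ∑ i ∈ Finset.Ico 0 t.coords.length, t.coords.getD i 0 =
      (t.coords.length : ℝ) * (t.coords.length + 1) / 2 := by
  induction t with
  | leaf => simp [coords]
  | node l r ihl ihr =>
    have hlen : (node l r).coords.length = r.coords.length + (l.coords.length + 1) := by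
      simp only [coords, List.length_append, List.length_cons]; omega
    rw [hlen, sum_Ico_coords_node_root l r _ (Nat.zero_le _), ihl, ihr,
      leaves_eq_length_coords_add_one, leaves_eq_length_coords_add_one]
    push_cast
    ring

/-- The sum of `k` consecutive coordinates of `M(t)` is at least `k (k + 1) / 2`. -/
theorem le_sum_Ico_coords (t : PBT) (a k : ℕ) (h : a + k ≤ t.coords.length) :
    (k : ℝ) * (k + 1) / 2 ≤ ∑ i ∈ Finset.Ico a (a + k), t.coords.getD i 0 := by
  induction t generalizing a k with
  | leaf =>
    obtain ⟨rfl, rfl⟩ : a = 0 ∧ k = 0 := by simpa [coords] using h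
    simp
  | node l r ihl ihr =>
    have hlen : (node l r).coords.length = r.coords.length + (l.coords.length + 1) := by
      simp only [coords, List.length_append, List.length_cons]; omega
    rw [hlen] at h
    rcases le_or_gt (a + k) l.coords.length with hl | hl
    · rw [sum_Ico_coords_node_left l r a hl]
      exact ihl a k hl
    rcases le_or_gt a l.coords.length with ha | ha
    · obtain ⟨k₁, hk₁⟩ := Nat.exists_eq_add_of_le ha
      obtain ⟨k₂, hk₂⟩ := Nat.exists_eq_add_of_le' (Nat.succ_le_of_lt hl)
      have hk₂r : k₂ ≤ r.coords.length := by omega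
      have hleft := ihl a k₁ hk₁.ge
      have hright := ihr 0 k₂ (by omega)
      rw [hk₂, Nat.succ_eq_add_one, sum_Ico_coords_node_root l r k₂ ha]
      rw [← hk₁] at hleft
      rw [Nat.zero_add] at hright
      have hroot : ((k₁ : ℝ) + 1) * (k₂ + 1) ≤ (l.leaves : ℝ) * r.leaves := by
        rw [leaves_eq_length_coords_add_one, leaves_eq_length_coords_add_one]
        exact_mod_cast Nat.mul_le_mul (by omega : k₁ + 1 ≤ l.coords.length + 1)
          (by omega : k₂ + 1 ≤ r.coords.length + 1)
      obtain rfl : k = k₁ + k₂ + 1 := by omega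
      push_cast
      linarith
    · obtain ⟨a', rfl⟩ := Nat.exists_eq_add_of_le' (Nat.succ_le_of_lt ha)
      rw [show a' + l.coords.length.succ + k = a' + k + (l.coords.length + 1) by omega,
        Nat.succ_eq_add_one, sum_Ico_coords_node_right]
      exact ihr a' k (by omega)

end PBT

theorem Fin.sum_filter_Ico_val {n a b : ℕ} (hb : b ≤ n) (f : ℕ → ℝ) :
    ∑ i ∈ Finset.univ.filter (fun i : Fin n => a ≤ (i : ℕ) ∧ (i : ℕ) < b), f i =
      ∑ i ∈ Finset.Ico a b, f i := by
  rw [Finset.sum_filter, Fin.sum_univ_eq_sum_range (fun i => if a ≤ i ∧ i < b then f i else 0),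
    ← Finset.sum_filter]
  refine Finset.sum_congr ?_ fun _ _ => rfl
  ext i
  simp only [Finset.mem_filter, Finset.mem_range, Finset.mem_Ico]
  omega

/-- For every planar binary tree `t ∈ Y n` and every admissible shuffle `ω` of
`{1,…,n}`, one has `p_ω(M(t)) ≥ 0`. -/
theorem stmt1 (n : ℕ) (t : PBT) (ht : t.coords.length = n)
    (A : Finset (Fin n)) (hA : IsAdmissible n A) :
    0 ≤ pShuffle n A (PBT.M n t) := by
  obtain ⟨r, k, -, -, hrk, hA⟩ := hA
  have hcard : (A.card : ℝ) = k := by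
    have h := Fin.sum_filter_Ico_val (a := r) hrk (fun _ => 1)
    rw [← hA] at h
    simpa using h
  have hsum : ∑ i ∈ A, PBT.M n t i = ∑ i ∈ Finset.Ico r (r + k), t.coords.getD i 0 := by
    rw [hA]
    exact Fin.sum_filter_Ico_val hrk (fun i => t.coords.getD i 0)
  have htotal : ∑ i ∈ A, PBT.M n t i + ∑ i ∈ Aᶜ, PBT.M n t i = (n : ℝ) * (n + 1) / 2 := by
    rw [Finset.sum_add_sum_compl, ← ht, ← PBT.sum_Ico_coords_eq, ← Finset.range_eq_Ico]
    exact Fin.sum_univ_eq_sum_range (fun i => t.coords.getD i 0) _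
  have hle := PBT.le_sum_Ico_coords t r k (ht ▸ hrk)
  rw [← hsum] at hle
  have hp : pShuffle n A (PBT.M n t) = n * (∑ i ∈ A, PBT.M n t i - (k : ℝ) * (k + 1) / 2) := by
    rw [pShuffle, hcard]
    linear_combination (-(k : ℝ)) * htotal
  rw [hp]
  exact mul_nonneg n.cast_nonneg (sub_nonneg.mpr hle)
end

section
/- For every permutation σ of {1,…,n} and every shuffle ω = (ω_1 ⋯ ω_k | ω_{k+1} ⋯ ω_n) of {1,…,n}, one has p_ω(M(σ)) ≥ 0, with equality if and only if σ maps the set {ω_1,…,ω_k} onto the set {1,…,k}. -/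
/-- The permutohedron vertex `M(σ) = (σ(1), …, σ(n))`
(0-indexed: the `i`-th coordinate is `σ(i) + 1`). -/
noncomputable def Mperm (n : ℕ) (σ : Equiv.Perm (Fin n)) : Fin n → ℝ :=
  fun i => ((σ i : ℕ) : ℝ) + 1

/-- A finite set of `k` natural numbers has sum at least `0 + 1 + ⋯ + (k - 1)`, with an excess
of at least the number of elements of `{0, …, k - 1}` that it misses. -/
theorem sum_range_card_add_card_sdiff_le_sum (s : Finset ℕ) :
    ∑ x ∈ Finset.range s.card, x + (Finset.range s.card \ s).card ≤ ∑ x ∈ s, x := by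
  set r := Finset.range s.card with hr
  have hcard : (r \ s).card = (s \ r).card :=
    Finset.card_sdiff_comm (by simp [hr])
  have hlow : ∑ x ∈ r \ s, (x + 1) ≤ (r \ s).card * s.card := by
    refine Finset.sum_le_card_nsmul _ _ _ fun x hx => ?_
    simp only [hr, Finset.mem_sdiff, Finset.mem_range] at hx
    omega
  have hhigh : (s \ r).card * s.card ≤ ∑ x ∈ s \ r, x := by
    refine Finset.card_nsmul_le_sum _ _ _ fun x hx => ?_
    simp only [hr, Finset.mem_sdiff, Finset.mem_range] at hx
    omega
  have hs := Finset.sum_inter_add_sum_sdiff s r fun x => x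
  have hr' := Finset.sum_inter_add_sum_sdiff r s fun x => x
  rw [Finset.inter_comm] at hr'
  rw [Finset.sum_add_distrib, Finset.sum_const, smul_eq_mul, mul_one] at hlow
  rw [hcard] at hlow ⊢
  omega

theorem sum_range_card_le_sum (s : Finset ℕ) :
    ∑ x ∈ Finset.range s.card, x ≤ ∑ x ∈ s, x :=
  (Nat.le_add_right _ _).trans (sum_range_card_add_card_sdiff_le_sum s)

theorem sum_eq_sum_range_card_iff (s : Finset ℕ) :
    ∑ x ∈ s, x = ∑ x ∈ Finset.range s.card, x ↔ s = Finset.range s.card := by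
  refine ⟨fun h => ?_, fun h => congrArg (fun t : Finset ℕ => ∑ x ∈ t, x) h⟩
  have hle := sum_range_card_add_card_sdiff_le_sum s
  have hsub : Finset.range s.card ⊆ s :=
    Finset.sdiff_eq_empty_iff_subset.mp (Finset.card_eq_zero.mp (by omega))
  exact (Finset.eq_of_subset_of_card_le hsub (by simp)).symm

theorem cast_sum_range_id (k : ℕ) :
    ((∑ x ∈ Finset.range k, x : ℕ) : ℝ) = (k : ℝ) * (k - 1) / 2 := by
  induction k with
  | zero => simp
  | succ k ih => rw [Finset.sum_range_succ, Nat.cast_add, ih]; push_cast; ring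

/-- On a vertex of the permutohedron, `p_ω` is `n` times the excess of the sum of the values
taken on the first block over the least possible such sum. -/
theorem pShuffle_Mperm (n : ℕ) (σ : Equiv.Perm (Fin n)) (A : Finset (Fin n)) :
    pShuffle n A (Mperm n σ) =
      n * (((∑ i ∈ A, (σ i : ℕ) : ℕ) : ℝ) - (∑ x ∈ Finset.range A.card, x : ℕ)) := by
  have htotal : ∑ i, Mperm n σ i = (n : ℝ) * (n - 1) / 2 + n := by
    rw [← cast_sum_range_id, ← Fin.sum_univ_eq_sum_range (fun x => x),
      ← Equiv.sum_comp σ fun i : Fin n => (i : ℕ)]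
    simp [Mperm, Finset.sum_add_distrib]
  have hA : ∑ i ∈ A, Mperm n σ i = ((∑ i ∈ A, (σ i : ℕ) : ℕ) : ℝ) + A.card := by
    simp [Mperm, Finset.sum_add_distrib]
  have hcompl : ∑ i ∈ Aᶜ, Mperm n σ i =
      (n : ℝ) * (n - 1) / 2 + n - (((∑ i ∈ A, (σ i : ℕ) : ℕ) : ℝ) + A.card) := by
    rw [← htotal, ← hA, ← Finset.sum_add_sum_compl A, add_sub_cancel_left]
  rw [pShuffle, hcompl, hA, cast_sum_range_id]
  ring

/-- A set of `Fin n` of cardinality `k` consists of the first `k` elements iff its image in `ℕ`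
is `{0, …, k - 1}`. -/
theorem map_val_eq_range_card_iff {n : ℕ} (B : Finset (Fin n)) :
    B.map Fin.valEmbedding = Finset.range B.card ↔
      B = Finset.univ.filter fun i : Fin n => (i : ℕ) < B.card := by
  have hB : B.card ≤ n := by simpa using B.card_le_univ
  have hrange : (Finset.univ.filter fun i : Fin n => (i : ℕ) < B.card).map Fin.valEmbedding =
      Finset.range B.card := by
    ext x
    simp only [Finset.mem_map, Finset.mem_filter, Finset.mem_univ, true_and, Finset.mem_range,
      Fin.valEmbedding_apply]
    exact ⟨fun ⟨i, hi, h⟩ => h ▸ hi, fun hx => ⟨⟨x, hx.trans_le hB⟩, hx, rfl⟩⟩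
  rw [← hrange, Finset.map_inj]

/-- For every permutation `σ` of `{1,…,n}` and every shuffle `ω` of `{1,…,n}` (both
blocks nonempty), one has `p_ω(M(σ)) ≥ 0`, with equality if and only if `σ` maps the
first block `{ω_1,…,ω_k}` onto the set `{1,…,k}` (0-indexed: onto `{i : i < k}`). -/
theorem stmt5 (n : ℕ) (σ : Equiv.Perm (Fin n)) (A : Finset (Fin n))
    (h1 : A.Nonempty) (h2 : Aᶜ.Nonempty) :
    0 ≤ pShuffle n A (Mperm n σ) ∧
    (pShuffle n A (Mperm n σ) = 0 ↔
      A.image (fun i => σ i) = Finset.univ.filter fun i : Fin n => (i : ℕ) < A.card) := by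
  obtain ⟨a, -⟩ := h1
  have hn : (0 : ℝ) < n := by exact_mod_cast a.pos
  set B := A.image fun i => σ i with hB
  have hcard : B.card = A.card := Finset.card_image_of_injective A σ.injective
  have hsum : ∑ i ∈ A, (σ i : ℕ) = ∑ x ∈ B.map Fin.valEmbedding, x := by
    rw [Finset.sum_map, hB, Finset.sum_image σ.injective.injOn]
    rfl
  have hle := sum_range_card_le_sum (B.map Fin.valEmbedding)
  have heq := sum_eq_sum_range_card_iff (B.map Fin.valEmbedding)
  rw [Finset.card_map] at hle heq
  rw [map_val_eq_range_card_iff] at heq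
  rw [hcard, ← hsum] at hle heq
  rw [pShuffle_Mperm]
  refine ⟨mul_nonneg hn.le (sub_nonneg.mpr (by exact_mod_cast hle)), ?_⟩
  rw [mul_eq_zero, or_iff_right hn.ne', sub_eq_zero, Nat.cast_inj, heq]
end

section
/- For n ≥ 1, the set {M(t) : t ∈ Y_n} ∩ {M(σ) : σ ∈ S_n} of points of ℝ^n that are simultaneously vertices of the Stasheff polytope and of the permutohedron has exactly 2^{n−1} elements. -/
namespace PBT

/-- The coordinates of Loday's point as natural numbers. -/
def natCoords : PBT → List ℕ
  | leaf => []
  | node l r => l.natCoords ++ (l.leaves * r.leaves) :: r.natCoords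

theorem leaves_eq_length_add_one (t : PBT) : t.leaves = t.natCoords.length + 1 := by
  induction t with
  | leaf => rfl
  | node l r hl hr =>
    simp only [leaves, natCoords, hl, hr, List.length_append, List.length_cons]
    omega

theorem coords_eq_map (t : PBT) : t.coords = t.natCoords.map (Nat.cast : ℕ → ℝ) := by
  induction t with
  | leaf => rfl
  | node l r hl hr => simp [coords, natCoords, hl, hr]

/-- A list which is an arrangement of `1, …, n`. -/
def IsArrangement (n : ℕ) (l : List ℕ) : Prop :=
  l.length = n ∧ l.Nodup ∧ ∀ x ∈ l, 1 ≤ x ∧ x ≤ n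

theorem isArrangement_cons {n : ℕ} {l : List ℕ} :
    IsArrangement (n + 1) ((n + 1) :: l) ↔ IsArrangement n l := by
  simp only [IsArrangement, List.length_cons, List.nodup_cons, List.mem_cons, add_left_inj]
  constructor
  · rintro ⟨h₁, ⟨h₂, h₃⟩, h₄⟩
    refine ⟨h₁, h₃, fun x hx => ?_⟩
    have h := h₄ x (Or.inr hx)
    have hne : x ≠ n + 1 := fun h => h₂ (h ▸ hx)
    omega
  · rintro ⟨h₁, h₂, h₃⟩
    refine ⟨h₁, ⟨fun h => ?_, h₂⟩, ?_⟩
    · have := h₃ _ h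
      omega
    · rintro x (rfl | hx)
      · omega
      · have := h₃ x hx
        omega

theorem isArrangement_concat {n : ℕ} {l : List ℕ} :
    IsArrangement (n + 1) (l ++ [n + 1]) ↔ IsArrangement n l := by
  rw [← isArrangement_cons (l := l)]
  have h : (l ++ [n + 1]).Perm ((n + 1) :: l) := List.perm_append_singleton _ _
  simp only [IsArrangement, h.length_eq, h.nodup_iff, h.mem_iff]

/-- The arrangements of `1, …, n` obtained by successively inserting the next number at
the left or the right end. -/
def endInsertions : ℕ → Finset (List ℕ)
  | 0 => {[]}
  | n + 1 => (endInsertions n).image (fun l => (n + 1) :: l) ∪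
      (endInsertions n).image (fun l => l ++ [n + 1])

theorem mem_endInsertions {n : ℕ} {l : List ℕ} :
    l ∈ endInsertions n ↔ (∃ t : PBT, t.natCoords = l) ∧ IsArrangement n l := by
  induction n generalizing l with
  | zero =>
    simp only [endInsertions, Finset.mem_singleton]
    constructor
    · rintro rfl
      exact ⟨⟨leaf, rfl⟩, by simp [IsArrangement]⟩
    · rintro ⟨-, h, -⟩
      exact List.length_eq_zero_iff.mp h
  | succ n ih =>
    simp only [endInsertions, Finset.mem_union, Finset.mem_image, ih]
    constructor
    · rintro (⟨l, ⟨⟨t, rfl⟩, h⟩, rfl⟩ | ⟨l, ⟨⟨t, rfl⟩, h⟩, rfl⟩)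
      · refine ⟨⟨node leaf t, ?_⟩, isArrangement_cons.mpr h⟩
        simp [natCoords, leaves, leaves_eq_length_add_one t, h.1]
      · refine ⟨⟨node t leaf, ?_⟩, isArrangement_concat.mpr h⟩
        simp [natCoords, leaves, leaves_eq_length_add_one t, h.1]
    · rintro ⟨⟨t, rfl⟩, h⟩
      cases t with
      | leaf => simp [natCoords, IsArrangement] at h
      | node l r =>
        simp only [natCoords, leaves_eq_length_add_one] at h ⊢
        have hlen := h.1
        simp only [List.length_append, List.length_cons] at hlen
        have hle := (h.2.2 ((l.natCoords.length + 1) * (r.natCoords.length + 1)) (by simp)).2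
        have hz : l.natCoords.length * r.natCoords.length = 0 := by nlinarith
        rcases Nat.mul_eq_zero.mp hz with h₀ | h₀
        · have hr : r.natCoords.length = n := by omega
          rw [List.length_eq_zero_iff] at h₀
          simp only [h₀, hr, List.nil_append, List.length_nil, zero_add, one_mul] at h ⊢
          exact Or.inl ⟨_, ⟨⟨r, rfl⟩, isArrangement_cons.mp h⟩, rfl⟩
        · have hl : l.natCoords.length = n := by omega
          rw [List.length_eq_zero_iff] at h₀
          simp only [h₀, hl, List.length_nil, zero_add, mul_one] at h ⊢
          exact Or.inr ⟨_, ⟨⟨l, rfl⟩, isArrangement_concat.mp h⟩, rfl⟩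

theorem card_endInsertions (n : ℕ) : (endInsertions (n + 1)).card = 2 ^ n := by
  induction n with
  | zero => simp [endInsertions]
  | succ n ih =>
    rw [endInsertions, Finset.card_union_of_disjoint, Finset.card_image_of_injective,
      Finset.card_image_of_injective, ih, pow_succ, mul_two]
    · exact List.append_left_injective _
    · exact List.cons_injective
    · rw [Finset.disjoint_left]
      simp only [Finset.mem_image, not_exists, not_and]
      rintro _ ⟨l, -, rfl⟩ l' hl' h
      have ha := (mem_endInsertions.mp hl').2
      cases l' with
      | nil => simp [IsArrangement] at ha
      | cons a l' =>
        have hle := (ha.2.2 a (by simp)).2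
        simp only [List.cons_append, List.cons.injEq] at h
        omega

theorem M_apply (n : ℕ) (t : PBT) (i : Fin n) : M n t i = (t.natCoords.getD i 0 : ℕ) := by
  rw [M, coords_eq_map, ← Nat.cast_zero, List.getD_map]

theorem exists_perm_iff_isArrangement {n : ℕ} {l : List ℕ} (hl : l.length = n) :
    (∃ σ : Equiv.Perm (Fin n), ∀ i : Fin n, l.getD i 0 = (σ i : ℕ) + 1) ↔ IsArrangement n l := by
  subst hl
  simp only [Fin.is_lt, List.getD_eq_getElem]
  constructor
  · rintro ⟨σ, h⟩
    refine ⟨rfl, List.nodup_iff_injective_get.mpr fun i j hij => ?_, fun x hx => ?_⟩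
    · simp only [List.get_eq_getElem, h] at hij
      exact σ.injective (Fin.ext (by omega))
    · obtain ⟨i, rfl⟩ := List.mem_iff_get.mp hx
      simp only [List.get_eq_getElem, h]
      have := (σ i).is_lt
      omega
  · rintro ⟨-, hnd, hb⟩
    have hb' (i : Fin l.length) := hb l[i] (List.getElem_mem _)
    let f (i : Fin l.length) : Fin l.length := ⟨l[i] - 1, by have := hb' i; omega⟩
    have hf : Function.Injective f := fun i j hij => by
      have h : l[i] - 1 = l[j] - 1 := congrArg Fin.val hij
      have hi := hb' i
      have hj := hb' j
      exact List.nodup_iff_injective_get.mp hnd (show l[i] = l[j] by omega)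
    refine ⟨Equiv.ofBijective f (Finite.injective_iff_bijective.mp hf), fun i => ?_⟩
    have hi := hb' i
    change l[i] = l[i] - 1 + 1
    omega

end PBT

open PBT in
theorem inter_eq_image_endInsertions (n : ℕ) :
    ({x : Fin n → ℝ | ∃ t : PBT, t.coords.length = n ∧ x = PBT.M n t} ∩
      {x : Fin n → ℝ | ∃ σ : Equiv.Perm (Fin n), x = Mperm n σ}) =
    (fun (l : List ℕ) (i : Fin n) => ((l.getD i 0 : ℕ) : ℝ)) '' (endInsertions n : Set (List ℕ)) := by
  ext x
  simp only [Set.mem_inter_iff, Set.mem_ofPred_eq, Set.mem_image, Finset.mem_coe,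
    mem_endInsertions]
  constructor
  · rintro ⟨⟨t, ht, rfl⟩, σ, hσ⟩
    rw [coords_eq_map, List.length_map] at ht
    refine ⟨t.natCoords, ⟨⟨t, rfl⟩, (exists_perm_iff_isArrangement ht).mp ⟨σ, fun i => ?_⟩⟩, ?_⟩
    · have h := congrFun hσ i
      rw [M_apply, Mperm] at h
      exact_mod_cast h
    · funext i
      rw [M_apply]
  · rintro ⟨_, ⟨⟨t, rfl⟩, h⟩, rfl⟩
    refine ⟨⟨t, by rw [coords_eq_map, List.length_map, h.1], ?_⟩, ?_⟩
    · funext i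
      rw [M_apply]
    · obtain ⟨σ, hσ⟩ := (exists_perm_iff_isArrangement h.1).mpr h
      refine ⟨σ, funext fun i => ?_⟩
      simp only [hσ, Mperm, Nat.cast_add, Nat.cast_one]

/-- For `n ≥ 1`, the set of points of `ℝ^n` that are simultaneously vertices of the
Stasheff polytope and of the permutohedron has exactly `2^{n−1}` elements. -/
theorem stmt9 (n : ℕ) (hn : 1 ≤ n) :
    Set.ncard ({x : Fin n → ℝ | ∃ t : PBT, t.coords.length = n ∧ x = PBT.M n t} ∩
      {x : Fin n → ℝ | ∃ σ : Equiv.Perm (Fin n), x = Mperm n σ}) = 2 ^ (n - 1) := by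
  rw [inter_eq_image_endInsertions, Set.InjOn.ncard_image, Set.ncard_coe_finset]
  · obtain ⟨m, rfl⟩ := Nat.exists_eq_add_of_le' hn
    exact PBT.card_endInsertions m
  · intro l hl l' hl' h
    have h₁ := (PBT.mem_endInsertions.mp hl).2.1
    have h₂ := (PBT.mem_endInsertions.mp hl').2.1
    refine List.ext_getElem (h₁.trans h₂.symm) fun i hi hi' => ?_
    have h₃ := congrFun h ⟨i, h₁ ▸ hi⟩
    simpa [hi, hi'] using h₃
end

section
/- Let t, t' ∈ Y_n be related by a covering relation of the Tamari order: t' is obtained from t by replacing some subtree of the form (u ∨ v) ∨ w by u ∨ (v ∨ w). Then the Euclidean distance between M(t) and M(t') equals pr·√2, where p is the number of leaves of u and r is the number of leaves of w. In particular every edge length of this realization of the Stasheff polytope is an integral multiple of √2. -/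
/-- The covering relation of the Tamari order, recording the numbers of leaves `p` of
`u` and `r` of `w`: somewhere inside the tree, a subtree of the form `(u ∨ v) ∨ w` is
replaced by `u ∨ (v ∨ w)`. -/
inductive TamariCovAt : ℕ → ℕ → PBT → PBT → Prop
  | rot (u v w : PBT) :
      TamariCovAt u.leaves w.leaves (PBT.node (PBT.node u v) w) (PBT.node u (PBT.node v w))
  | left {p r : ℕ} {l l' : PBT} (s : PBT) :
      TamariCovAt p r l l' → TamariCovAt p r (PBT.node l s) (PBT.node l' s)
  | right (s : PBT) {p r : ℕ} {t t' : PBT} :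
      TamariCovAt p r t t' → TamariCovAt p r (PBT.node s t) (PBT.node s t')

namespace List

theorem sum_sq_sub_getD_eq_sum_zipWith {R : Type*} [CommRing R] :
    ∀ a b : List R, a.length = b.length →
      ∑ i : Fin a.length, (a.getD i 0 - b.getD i 0) ^ 2
        = (zipWith (fun x y => (x - y) ^ 2) a b).sum
  | [], [], _ => by simp
  | x :: a, y :: b, h => by
    have ih := sum_sq_sub_getD_eq_sum_zipWith a b (by simpa using h)
    rw [zipWith_cons_cons, sum_cons, ← ih]
    exact Fin.sum_univ_succ (n := a.length) _

end List

/-- A Tamari cover moves the amount `p * r` from one coordinate of `M(t)` to an earlier one. -/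
theorem TamariCovAt.exists_coords_eq {p r : ℕ} {t t' : PBT} (h : TamariCovAt p r t t') :
    t.leaves = t'.leaves ∧ ∃ (a b c : List ℝ) (x y : ℝ),
      t.coords = a ++ x :: (b ++ (y + p * r) :: c) ∧
      t'.coords = a ++ (x + p * r) :: (b ++ y :: c) := by
  induction h with
  | rot u v w =>
    refine ⟨Nat.add_assoc _ _ _, u.coords, v.coords, w.coords,
      u.leaves * v.leaves, v.leaves * w.leaves, ?_, ?_⟩
    · simp only [PBT.coords, PBT.leaves, List.append_assoc, List.cons_append]
      push_cast
      ring_nf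
    · simp only [PBT.coords, PBT.leaves]
      push_cast
      ring_nf
  | @left p r l l' s _ ih =>
    obtain ⟨hl, a, b, c, x, y, h₁, h₂⟩ := ih
    refine ⟨by simp [PBT.leaves, hl], a, b, c ++ ((l'.leaves * s.leaves : ℝ) :: s.coords),
      x, y, ?_, ?_⟩
    · simp only [PBT.coords, h₁, hl, List.append_assoc, List.cons_append]
    · simp only [PBT.coords, h₂, List.append_assoc, List.cons_append]
  | @right s p r t t' _ ih =>
    obtain ⟨hl, a, b, c, x, y, h₁, h₂⟩ := ih
    refine ⟨by simp [PBT.leaves, hl], s.coords ++ ((s.leaves * t'.leaves : ℝ) :: a), b, c,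
      x, y, ?_, ?_⟩
    · simp only [PBT.coords, h₁, hl, List.append_assoc, List.cons_append]
    · simp only [PBT.coords, h₂, List.append_assoc, List.cons_append]

/-- If `t, t' ∈ Y n` are related by a covering relation of the Tamari order, `t'`
obtained from `t` by replacing a subtree `(u ∨ v) ∨ w` by `u ∨ (v ∨ w)`, then the
Euclidean distance between `M(t)` and `M(t')` equals `p·r·√2`, where `p` is the number
of leaves of `u` and `r` the number of leaves of `w`.  In particular every edge length
of this realization of the Stasheff polytope is an integral multiple of `√2`. -/
theorem stmt12 (n p r : ℕ) (t t' : PBT) (ht : t.coords.length = n)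
    (h : TamariCovAt p r t t') :
    Real.sqrt (∑ i : Fin n, (PBT.M n t i - PBT.M n t' i) ^ 2)
      = (p : ℝ) * (r : ℝ) * Real.sqrt 2 ∧
    ∃ m : ℕ, Real.sqrt (∑ i : Fin n, (PBT.M n t i - PBT.M n t' i) ^ 2)
      = (m : ℝ) * Real.sqrt 2 := by
  obtain ⟨-, a, b, c, x, y, h₁, h₂⟩ := h.exists_coords_eq
  have hsum : ∑ i : Fin n, (PBT.M n t i - PBT.M n t' i) ^ 2 = ((p : ℝ) * r) ^ 2 * 2 := by
    subst ht
    unfold PBT.M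
    rw [List.sum_sq_sub_getD_eq_sum_zipWith _ _ (by simp [h₁, h₂]), h₁, h₂,
      List.zipWith_append rfl, List.zipWith_cons_cons, List.zipWith_append rfl,
      List.zipWith_cons_cons]
    simp
    ring
  have hdist : Real.sqrt (∑ i : Fin n, (PBT.M n t i - PBT.M n t' i) ^ 2)
      = (p : ℝ) * (r : ℝ) * Real.sqrt 2 := by
    rw [hsum, Real.sqrt_mul (sq_nonneg _), Real.sqrt_sq (by positivity)]
  exact ⟨hdist, p * r, by rw [hdist, Nat.cast_mul]⟩
end

section
/- The only points of ℝ^n that are simultaneously a cube vertex M(ε) for some ε ∈ {0,1}^{n−1} and a permutohedron vertex M(σ) for some permutation σ of {1,…,n} are the two points (1, 2, …, n) and (n, n−1, …, 1): that is, {M(ε) : ε ∈ {0,1}^{n−1}} ∩ {M(σ) : σ ∈ S_n} = {(1,2,…,n), (n,n−1,…,1)}. -/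
/-- `ε = (ε_1, …, ε_{n−1}) ∈ {0,1}^{n−1}`, with the convention `ε_0 = ε_n = 0`. -/
def CubeEps (n : ℕ) (ε : ℕ → ℝ) : Prop :=
  ε 0 = 0 ∧ ε n = 0 ∧ ∀ i, ε i = 0 ∨ ε i = 1

/-- The cube vertex `M(ε) ∈ ℝ^n`: `x_i = i − ε_{i−1}(n−i+1)(i−1) + ε_i(n−i)i` for
`i = 1, …, n` (0-indexed `j = i − 1`). -/
noncomputable def Mcube (n : ℕ) (ε : ℕ → ℝ) : Fin n → ℝ :=
  fun j => (((j : ℕ) : ℝ) + 1) - ε (j : ℕ) * ((n : ℝ) - ((j : ℕ) : ℝ)) * ((j : ℕ) : ℝ)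
    + ε ((j : ℕ) + 1) * ((n : ℝ) - ((j : ℕ) : ℝ) - 1) * (((j : ℕ) : ℝ) + 1)

/-- If `ε` is constant equal to `c` on `{1, …, n - 1}`, then `M(ε)` lies on the line through
`(1, …, n)` and `(n, …, 1)`. -/
theorem Mcube_of_const (n : ℕ) (ε : ℕ → ℝ) (c : ℝ) (h : ∀ i, 0 < i → i < n → ε i = c)
    (j : Fin n) :
    Mcube n ε j = ((j : ℕ) : ℝ) + 1 + c * ((n : ℝ) - 1 - 2 * ((j : ℕ) : ℝ)) := by
  have h1 : ε j * ((j : ℕ) : ℝ) = c * ((j : ℕ) : ℝ) := by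
    rcases Nat.eq_zero_or_pos (j : ℕ) with h0 | h0
    · simp [h0]
    · rw [h _ h0 j.2]
  have h2 : ε (j + 1) * ((n : ℝ) - ((j : ℕ) : ℝ) - 1) = c * ((n : ℝ) - ((j : ℕ) : ℝ) - 1) := by
    rcases (Nat.succ_le_of_lt j.2).eq_or_lt with h0 | h0
    · have : (n : ℝ) - ((j : ℕ) : ℝ) - 1 = 0 := by
        have : ((j : ℕ) : ℝ) + 1 = n := by exact_mod_cast h0
        linarith
      simp [this]
    · rw [h _ (Nat.succ_pos _) h0]
  unfold Mcube
  linear_combination (-((n : ℝ) - ((j : ℕ) : ℝ))) * h1 + (((j : ℕ) : ℝ) + 1) * h2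

/-- If the coordinates of `M(ε)` all lie in `[1, n]`, then `ε` is constant on `{1, …, n - 1}`. -/
theorem CubeEps.eq_of_Mcube_mem_Icc {n : ℕ} {ε : ℕ → ℝ} (hε : CubeEps n ε)
    (hM : ∀ j, Mcube n ε j ∈ Set.Icc (1 : ℝ) n) (i : ℕ) (h0 : 0 < i) (hn : i < n) :
    ε i = ε 1 := by
  induction i, h0 using Nat.le_induction with
  | base => rfl
  | succ i hi ih =>
    rw [← ih (by omega)]
    obtain ⟨hl, hu⟩ := hM ⟨i, by omega⟩
    have h1 : (1 : ℝ) ≤ i := by exact_mod_cast hi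
    have h2 : (i : ℝ) + 2 ≤ n := by exact_mod_cast hn
    have h3 : 0 < (i : ℝ) * ((n : ℝ) - i - 1) := mul_pos (by linarith) (by linarith)
    simp only [Mcube] at hl hu
    rcases hε.2.2 i with ha | ha <;> rcases hε.2.2 (i + 1) with hb | hb <;>
      rw [ha, hb] at hl hu ⊢ <;> exfalso <;> nlinarith

/-- The only points of `ℝ^n` that are simultaneously a cube vertex `M(ε)`,
`ε ∈ {0,1}^{n−1}`, and a permutohedron vertex `M(σ)`, `σ ∈ S_n`, are the two points
`(1, 2, …, n)` and `(n, n−1, …, 1)`. -/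
theorem stmt14 (n : ℕ) :
    {x : Fin n → ℝ | ∃ ε : ℕ → ℝ, CubeEps n ε ∧ x = Mcube n ε} ∩
      {x : Fin n → ℝ | ∃ σ : Equiv.Perm (Fin n), x = Mperm n σ} =
    {(fun j : Fin n => ((j : ℕ) : ℝ) + 1), (fun j : Fin n => (n : ℝ) - ((j : ℕ) : ℝ))} := by
  ext x
  simp only [Set.mem_inter_iff, Set.mem_ofPred_eq, Set.mem_insert_iff, Set.mem_singleton_iff]
  constructor
  · rintro ⟨⟨ε, hε, rfl⟩, σ, hσ⟩
    have hM : ∀ j, Mcube n ε j ∈ Set.Icc (1 : ℝ) n := by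
      intro j
      have : (((σ j : ℕ) + 1 : ℕ) : ℝ) ≤ n := by exact_mod_cast (σ j).2
      rw [hσ]
      constructor
      · simp [Mperm]
      · simpa [Mperm] using this
    have hc := Mcube_of_const n ε (ε 1) (hε.eq_of_Mcube_mem_Icc hM)
    rcases hε.2.2 1 with h | h
    · left
      funext j
      rw [hc, h]
      ring
    · right
      funext j
      rw [hc, h]
      ring
  · rintro (rfl | rfl)
    · refine ⟨⟨fun _ => 0, ⟨rfl, rfl, fun _ => Or.inl rfl⟩, ?_⟩, 1, rfl⟩
      funext j
      simp [Mcube]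
    · refine ⟨⟨fun i => if 0 < i ∧ i < n then 1 else 0, ⟨by simp, by simp, fun i => ?_⟩, ?_⟩,
        Fin.revPerm, ?_⟩
      · dsimp only
        split_ifs <;> simp
      · funext j
        rw [Mcube_of_const n _ 1 fun i h0 hn => if_pos ⟨h0, hn⟩]
        ring
      · funext j
        simp only [Mperm, Fin.revPerm_apply, Fin.val_rev]
        rw [Nat.cast_sub (Nat.succ_le_of_lt j.2)]
        push_cast
        ring
end

section
/- For n ≥ 1, the set {M(t) : t ∈ Y_n} ∩ {M(ε) : ε ∈ {0,1}^{n−1}} of points of ℝ^n that are simultaneously vertices of the Stasheff polytope and of the cube has exactly n elements; a tree t ∈ Y_n gives such a common vertex if and only if its leaf-direction vector φ(t) is of the form (1, …, 1, 0, …, 0). -/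
namespace PBT

/-- The leaf-direction list `φ(t)` of the interior leaves `1, …, n−1` of `t ∈ Y n`
(the extreme leaves `0` and `n` are excluded): the entry for leaf `i` is `0` if the
`i`-th leaf points to the left (it is a left child of its parent vertex) and `1` if
it points to the right (it is a right child).  In `t = l ∨ r`, the interior leaves of
`t` are the interior leaves of `l`, then (when `l` is not a single leaf) the rightmost
leaf of `l`, which is a right child, then (when `r` is not a single leaf) the leftmost
leaf of `r`, which is a left child, then the interior leaves of `r`. -/
noncomputable def phi : PBT → List ℝ
  | leaf => []
  | node leaf leaf => []
  | node leaf (node rl rr) => 0 :: phi (node rl rr)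
  | node (node ll lr) leaf => phi (node ll lr) ++ [1]
  | node (node ll lr) (node rl rr) => (phi (node ll lr) ++ [1]) ++ 0 :: phi (node rl rr)

end PBT

/-- `φ(t) = ε`, i.e. the leaf-direction vector of `t` is `(ε_1, …, ε_{n−1})`. -/
noncomputable def phiEq (n : ℕ) (ε : ℕ → ℝ) (t : PBT) : Prop :=
  PBT.phi t = List.ofFn fun i : Fin (n - 1) => ε ((i : ℕ) + 1)

namespace PBT

/-- The left comb with `m` internal vertices. -/
def leftComb : ℕ → PBT
  | 0 => leaf
  | m + 1 => node (leftComb m) leaf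

/-- The right comb with `m` internal vertices. -/
def rightComb : ℕ → PBT
  | 0 => leaf
  | m + 1 => node leaf (rightComb m)

theorem length_coords_node (l r : PBT) :
    (node l r).coords.length = l.coords.length + r.coords.length + 1 := by
  simp [coords]; omega

theorem eq_leaf_of_length_coords {t : PBT} (h : t.coords.length = 0) : t = leaf := by
  cases t with
  | leaf => rfl
  | node l r => simp [coords] at h

theorem coords_node_getD_left {l : PBT} (r : PBT) {i : ℕ} (h : i < l.coords.length) :
    (node l r).coords.getD i 0 = l.coords.getD i 0 := by
  rw [coords, List.getD_append _ _ _ _ h]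

theorem coords_node_getD_root (l r : PBT) :
    (node l r).coords.getD l.coords.length 0 =
      ((l.coords.length : ℝ) + 1) * ((r.coords.length : ℝ) + 1) := by
  rw [coords, List.getD_append_right _ _ _ _ le_rfl]
  simp [leaves_eq_length_coords_add_one]

theorem coords_node_getD_right (l r : PBT) (i : ℕ) :
    (node l r).coords.getD (l.coords.length + 1 + i) 0 = r.coords.getD i 0 := by
  rw [coords, List.getD_append_right _ _ _ _ (by omega),
    show l.coords.length + 1 + i - l.coords.length = i + 1 by omega, List.getD_cons_succ]

theorem one_le_of_mem_coords {t : PBT} {x : ℝ} (h : x ∈ t.coords) : 1 ≤ x := by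
  induction t with
  | leaf => simp [coords] at h
  | node l r hl hr =>
    simp only [coords, List.mem_append, List.mem_cons] at h
    rcases h with h | rfl | h
    · exact hl h
    · rw [leaves_eq_length_coords_add_one, leaves_eq_length_coords_add_one]
      exact_mod_cast Nat.one_le_iff_ne_zero.2 (by positivity)
    · exact hr h

theorem one_le_M {n : ℕ} {t : PBT} (ht : t.coords.length = n) (i : Fin n) : 1 ≤ M n t i := by
  have hi : (i : ℕ) < t.coords.length := ht ▸ i.isLt
  rw [M, List.getD_eq_getElem _ _ hi]
  exact one_le_of_mem_coords (List.getElem_mem hi)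

@[simp]
theorem length_coords_leftComb (m : ℕ) : (leftComb m).coords.length = m := by
  induction m with
  | zero => rfl
  | succ m ih => rw [leftComb, length_coords_node, ih]; rfl

@[simp]
theorem length_coords_rightComb (m : ℕ) : (rightComb m).coords.length = m := by
  induction m with
  | zero => rfl
  | succ m ih => rw [rightComb, length_coords_node, ih]; simp [coords]

theorem coords_leftComb_getD {m i : ℕ} (h : i < m) :
    (leftComb m).coords.getD i 0 = (i : ℝ) + 1 := by
  induction m with
  | zero => omega
  | succ m ih =>
    rw [leftComb]
    rcases Nat.lt_succ_iff_lt_or_eq.1 h with h | rfl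
    · rw [coords_node_getD_left _ (by simpa using h), ih h]
    · simpa [coords] using coords_node_getD_root (leftComb i) leaf

theorem coords_rightComb_getD {m i : ℕ} (h : i < m) :
    (rightComb m).coords.getD i 0 = (m : ℝ) - i := by
  induction m generalizing i with
  | zero => omega
  | succ m ih =>
    rw [rightComb]
    rcases i with _ | i
    · simpa [coords] using coords_node_getD_root leaf (rightComb m)
    · have := coords_node_getD_right leaf (rightComb m) i
      rw [show leaf.coords.length + 1 + i = i + 1 by simp [coords]; omega] at this
      rw [this, ih (by omega)]
      push_cast
      ring

theorem eq_leftComb {t : PBT}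
    (h : ∀ i < t.coords.length, t.coords.getD i 0 = (i : ℝ) + 1) :
    t = leftComb t.coords.length := by
  induction t with
  | leaf => rfl
  | node l r hl _ =>
    have hlen := length_coords_node l r
    have hroot := h l.coords.length (by omega)
    rw [coords_node_getD_root] at hroot
    have hr : r.coords.length = 0 := by
      have : (r.coords.length : ℝ) = 0 := by
        have : (0 : ℝ) < (l.coords.length : ℝ) + 1 := by positivity
        nlinarith
      exact_mod_cast this
    rw [hlen, hr, eq_leaf_of_length_coords hr, leftComb, ← hl]
    intro i hi
    rw [← coords_node_getD_left r hi]
    exact h i (by omega)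

theorem eq_rightComb {t : PBT}
    (h : ∀ i < t.coords.length, t.coords.getD i 0 = (t.coords.length : ℝ) - i) :
    t = rightComb t.coords.length := by
  induction t with
  | leaf => rfl
  | node l r _ hr =>
    have hlen := length_coords_node l r
    have hroot := h l.coords.length (by omega)
    rw [coords_node_getD_root, hlen] at hroot
    push_cast at hroot
    have hl : l.coords.length = 0 := by
      have : (l.coords.length : ℝ) = 0 := by
        have : (0 : ℝ) < (r.coords.length : ℝ) + 1 := by positivity
        nlinarith
      exact_mod_cast this
    rw [hlen, hl, eq_leaf_of_length_coords hl, zero_add, rightComb, ← hr]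
    intro i hi
    rw [← coords_node_getD_right l r, h _ (by omega), hlen, hl]
    push_cast
    ring

end PBT

/-- The point `(1, …, a, (a + 1)(n - a), n - a - 1, …, 1)` of `ℝ^n`, with `a < n`. -/
noncomputable def commonVertex (n a : ℕ) : Fin n → ℝ := fun i =>
  if (i : ℕ) < a then (i : ℝ) + 1
  else if (i : ℕ) = a then ((a : ℝ) + 1) * ((n : ℝ) - a)
  else (n : ℝ) - i

theorem commonVertex_injOn (n : ℕ) : Set.InjOn (commonVertex n) (Finset.range n) := by
  have ne_of_lt {a b : ℕ} (hab : a < b) (hb : b < n) : commonVertex n a ≠ commonVertex n b := by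
    intro h
    have h := congrFun h ⟨a, hab.trans hb⟩
    simp only [commonVertex, lt_irrefl, if_false, if_true, hab] at h
    have h1 : (a : ℝ) + 1 < n := by exact_mod_cast (by omega : a + 1 < n)
    have h2 : (0 : ℝ) < (a : ℝ) + 1 := by positivity
    nlinarith
  intro a ha b hb h
  simp only [Finset.coe_range, Set.mem_Iio] at ha hb
  rcases lt_trichotomy a b with hab | hab | hab
  · exact absurd h (ne_of_lt hab hb)
  · exact hab
  · exact absurd h.symm (ne_of_lt hab ha)

theorem Mcube_eq_commonVertex {n a : ℕ} {ε : ℕ → ℝ} (hε : CubeEps n ε)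
    (h0 : ∀ i ≤ a, ε i = 0) (h1 : ∀ i, a < i → i < n → ε i = 1) :
    Mcube n ε = commonVertex n a := by
  ext ⟨i, hi⟩
  simp only [Mcube, commonVertex]
  rcases lt_trichotomy i a with h | rfl | h
  · rw [if_pos h, h0 i h.le, h0 (i + 1) h]
    ring
  · rw [if_neg (lt_irrefl _), if_pos rfl, h0 i le_rfl]
    rcases Nat.lt_or_ge (i + 1) n with h' | h'
    · rw [h1 _ (by omega) h']
      ring
    · obtain rfl : n = i + 1 := by omega
      rw [hε.2.1]
      push_cast
      ring
  · rw [if_neg (by omega), if_neg (by omega), h1 i h hi]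
    rcases Nat.lt_or_ge (i + 1) n with h' | h'
    · rw [h1 _ (by omega) h']
      ring
    · obtain rfl : n = i + 1 := by omega
      rw [hε.2.1]
      push_cast
      ring

theorem exists_Mcube_eq_commonVertex (n a : ℕ) :
    ∃ ε, CubeEps n ε ∧ Mcube n ε = commonVertex n a := by
  have hε : CubeEps n fun i => if a < i ∧ i < n then 1 else 0 := by
    refine ⟨by simp, by simp, fun i => ?_⟩
    by_cases h : a < i ∧ i < n <;> simp [h]
  refine ⟨_, hε, Mcube_eq_commonVertex hε (fun i hi => ?_) fun i h h' => ?_⟩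
  · exact if_neg (by omega)
  · exact if_pos ⟨h, h'⟩

theorem exists_eq_commonVertex_of_one_le_Mcube {n : ℕ} (hn : 1 ≤ n) {ε : ℕ → ℝ}
    (hε : CubeEps n ε) (h : ∀ i, 1 ≤ Mcube n ε i) :
    ∃ a < n, Mcube n ε = commonVertex n a := by
  classical
  have step : ∀ i, i + 1 < n → ε i = 1 → ε (i + 1) = 1 := by
    intro i hi h1
    by_contra hne
    have h0 := (hε.2.2 (i + 1)).resolve_right hne
    have hM := h ⟨i, by omega⟩
    simp only [Mcube, h1, h0] at hM
    have hpos : 0 < i := by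
      rcases Nat.eq_zero_or_pos i with rfl | hpos
      · rw [hε.1] at h1
        norm_num at h1
      · exact hpos
    have hpos' : (0 : ℝ) < i := by exact_mod_cast hpos
    have hlt : (i : ℝ) + 1 < n := by exact_mod_cast hi
    nlinarith
  have hex : ∃ a, ε (a + 1) = 1 ∨ a + 1 = n := ⟨n - 1, Or.inr (by omega)⟩
  have hle : Nat.find hex ≤ n - 1 := Nat.find_min' hex (Or.inr (by omega))
  refine ⟨Nat.find hex, by omega, Mcube_eq_commonVertex hε ?_ ?_⟩
  · rintro (_ | i) hi
    · exact hε.1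
    · exact (hε.2.2 _).resolve_right fun h1 => Nat.find_min hex hi (Or.inl h1)
  · intro i hi
    induction i, (hi : Nat.find hex + 1 ≤ i) using Nat.le_induction with
    | base =>
      intro hlt
      exact (Nat.find_spec hex).resolve_right hlt.ne
    | succ i hai ih =>
      intro hlt
      exact step i hlt (ih (by omega))

namespace PBT

theorem M_node_combs {n a : ℕ} (ha : a < n) :
    M n (node (leftComb a) (rightComb (n - 1 - a))) = commonVertex n a := by
  obtain ⟨b, rfl⟩ : ∃ b, n = a + 1 + b := ⟨n - 1 - a, by omega⟩
  rw [show a + 1 + b - 1 - a = b by omega]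
  ext ⟨i, hi⟩
  simp only [M, commonVertex]
  rcases lt_trichotomy i a with h | rfl | h
  · rw [if_pos h, coords_node_getD_left _ (by simpa using h), coords_leftComb_getD h]
  · have := coords_node_getD_root (leftComb i) (rightComb b)
    rw [length_coords_leftComb, length_coords_rightComb] at this
    rw [if_neg (lt_irrefl _), if_pos rfl, this]
    push_cast
    ring
  · obtain ⟨j, rfl⟩ : ∃ j, i = a + 1 + j := ⟨i - (a + 1), by omega⟩
    have := coords_node_getD_right (leftComb a) (rightComb b) j
    rw [length_coords_leftComb, coords_rightComb_getD (by omega)] at this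
    rw [if_neg (by omega), if_neg (by omega), this]
    push_cast
    ring

theorem eq_node_combs_of_M_eq {n a : ℕ} (ha : a < n) {t : PBT} (ht : t.coords.length = n)
    (h : M n t = commonVertex n a) : t = node (leftComb a) (rightComb (n - 1 - a)) := by
  cases t with
  | leaf => simp [coords] at ht; omega
  | node l r =>
    rw [length_coords_node] at ht
    have hcoord : ∀ i (hi : i < n), (node l r).coords.getD i 0 = commonVertex n a ⟨i, hi⟩ :=
      fun i hi => congrFun h ⟨i, hi⟩
    have hroot := hcoord l.coords.length (by omega)
    rw [coords_node_getD_root] at hroot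
    simp only [commonVertex] at hroot
    have hn : (n : ℝ) = (l.coords.length : ℝ) + r.coords.length + 1 := by exact_mod_cast ht.symm
    have hl : l.coords.length = a := by
      rcases lt_trichotomy l.coords.length a with hlt | heq | hlt
      · rw [if_pos hlt] at hroot
        have : (1 : ℝ) ≤ r.coords.length := by
          exact_mod_cast (by omega : 1 ≤ r.coords.length)
        nlinarith [(Nat.cast_nonneg _ : (0 : ℝ) ≤ l.coords.length)]
      · exact heq
      · rw [if_neg (by omega), if_neg (by omega), hn] at hroot
        have : (1 : ℝ) ≤ l.coords.length := by
          exact_mod_cast (by omega : 1 ≤ l.coords.length)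
        nlinarith [(Nat.cast_nonneg _ : (0 : ℝ) ≤ r.coords.length)]
    have hr : r.coords.length = n - 1 - a := by omega
    congr 1
    · rw [← hl]
      refine eq_leftComb fun i hi => ?_
      rw [← coords_node_getD_left r hi, hcoord i (by omega)]
      exact if_pos (hl ▸ hi)
    · rw [← hr]
      refine eq_rightComb fun i hi => ?_
      rw [← coords_node_getD_right l r, hcoord _ (by omega)]
      simp only [commonVertex]
      rw [if_neg (by omega), if_neg (by omega), hn]
      push_cast
      ring

theorem exists_M_eq_Mcube_iff {n : ℕ} (hn : 1 ≤ n) {t : PBT} (ht : t.coords.length = n) :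
    (∃ ε, CubeEps n ε ∧ M n t = Mcube n ε) ↔
      ∃ a < n, t = node (leftComb a) (rightComb (n - 1 - a)) := by
  constructor
  · rintro ⟨ε, hε, h⟩
    obtain ⟨a, ha, h'⟩ :=
      exists_eq_commonVertex_of_one_le_Mcube hn hε fun i => h ▸ one_le_M ht i
    exact ⟨a, ha, eq_node_combs_of_M_eq ha ht (h.trans h')⟩
  · rintro ⟨a, ha, rfl⟩
    obtain ⟨ε, hε, h⟩ := exists_Mcube_eq_commonVertex n a
    exact ⟨ε, hε, (M_node_combs ha).trans h.symm⟩

theorem mem_phi {t : PBT} {x : ℝ} (h : x ∈ t.phi) : x = 0 ∨ x = 1 := by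
  induction t using phi.induct <;> simp only [phi] at h <;> grind

theorem phi_leftComb_succ (m : ℕ) : (leftComb (m + 1)).phi = List.replicate m 1 := by
  induction m with
  | zero => rfl
  | succ m ih =>
    rw [List.replicate_succ', ← ih]
    rfl

theorem phi_rightComb_succ (m : ℕ) : (rightComb (m + 1)).phi = List.replicate m 0 := by
  induction m with
  | zero => rfl
  | succ m ih =>
    rw [List.replicate_succ, ← ih]
    rfl

theorem phi_node_combs (a b : ℕ) :
    (node (leftComb a) (rightComb b)).phi = List.replicate a 1 ++ List.replicate b 0 := by
  rcases a with _ | a <;> rcases b with _ | b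
  · rfl
  · exact phi_rightComb_succ (b + 1)
  · exact (phi_leftComb_succ (a + 1)).trans (List.append_nil _).symm
  · rw [List.replicate_succ', List.replicate_succ (n := b), ← phi_leftComb_succ,
      ← phi_rightComb_succ]
    rfl

theorem eq_leftComb_of_phi {t : PBT} (h : ∀ x ∈ t.phi, x = 1) :
    t = leftComb t.coords.length := by
  induction t using phi.induct with
  | case1 => rfl
  | case2 => rfl
  | case3 rl rr _ => exact absurd (h 0 (by simp [phi])) zero_ne_one
  | case4 ll lr ih =>
    rw [length_coords_node]
    exact congrArg (node · leaf) (ih fun x hx => h x (by simp [phi, hx]))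
  | case5 ll lr rl rr _ _ => exact absurd (h 0 (by simp [phi])) zero_ne_one

theorem eq_rightComb_of_phi {t : PBT} (h : ∀ x ∈ t.phi, x = 0) :
    t = rightComb t.coords.length := by
  induction t using phi.induct with
  | case1 => rfl
  | case2 => rfl
  | case3 rl rr ih =>
    rw [length_coords_node, show leaf.coords.length = 0 from rfl, zero_add]
    exact congrArg (node leaf) (ih fun x hx => h x (by simp [phi, hx]))
  | case4 ll lr _ => exact absurd (h 1 (by simp [phi])) one_ne_zero
  | case5 ll lr rl rr _ _ => exact absurd (h 1 (by simp [phi])) one_ne_zero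

theorem eq_node_combs_of_pairwise_phi {l r : PBT}
    (h : (node l r).phi.Pairwise (· ≥ ·)) :
    node l r = node (leftComb l.coords.length) (rightComb r.coords.length) := by
  congr 1
  · cases l with
    | leaf => rfl
    | node ll lr =>
      have hl : (phi (node ll lr) ++ [1]).Pairwise (· ≥ ·) := by
        cases r with
        | leaf => exact h
        | node rl rr => exact (List.pairwise_append.1 h).1
      refine eq_leftComb_of_phi fun x hx => ?_
      have := (List.pairwise_append.1 hl).2.2 x hx 1 (by simp)
      rcases mem_phi hx with rfl | rfl
      · norm_num at this
      · rfl
  · cases r with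
    | leaf => rfl
    | node rl rr =>
      have hr : (0 :: phi (node rl rr)).Pairwise (· ≥ ·) := by
        cases l with
        | leaf => exact h
        | node ll lr => exact (List.pairwise_append.1 h).2.1
      refine eq_rightComb_of_phi fun x hx => ?_
      have := (List.pairwise_cons.1 hr).1 x hx
      rcases mem_phi hx with rfl | rfl
      · rfl
      · norm_num at this

theorem exists_phi_eq_iff {n : ℕ} (hn : 1 ≤ n) {t : PBT} (ht : t.coords.length = n) :
    (∃ k : ℕ, t.phi =
      List.ofFn fun i : Fin (n - 1) => if (i : ℕ) + 1 ≤ k then (1 : ℝ) else 0) ↔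
      ∃ a < n, t = node (leftComb a) (rightComb (n - 1 - a)) := by
  constructor
  · rintro ⟨k, h⟩
    cases t with
    | leaf => simp [coords] at ht; omega
    | node l r =>
      rw [length_coords_node] at ht
      refine ⟨l.coords.length, by omega, ?_⟩
      rw [show n - 1 - l.coords.length = r.coords.length by omega]
      apply eq_node_combs_of_pairwise_phi
      rw [h, List.pairwise_ofFn]
      intro i j hij
      have : (i : ℕ) < j := hij
      split_ifs <;> first | omega | norm_num
  · rintro ⟨a, ha, rfl⟩
    refine ⟨a, ?_⟩
    rw [phi_node_combs]
    refine List.ext_getElem (by simp; omega) fun i h₁ h₂ => ?_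
    simp only [List.getElem_append, List.length_replicate, List.getElem_replicate,
      List.getElem_ofFn, Nat.succ_le_iff]
    split_ifs <;> rfl

end PBT

/-- For `n ≥ 1`, the set of points of `ℝ^n` that are simultaneously vertices of the
Stasheff polytope and of the cube has exactly `n` elements; a tree `t ∈ Y n` gives
such a common vertex if and only if its leaf-direction vector `φ(t)` is of the form
`(1, …, 1, 0, …, 0)`. -/
theorem stmt16 (n : ℕ) (hn : 1 ≤ n) :
    Set.ncard ({x : Fin n → ℝ | ∃ t : PBT, t.coords.length = n ∧ x = PBT.M n t} ∩
      {x : Fin n → ℝ | ∃ ε : ℕ → ℝ, CubeEps n ε ∧ x = Mcube n ε}) = n ∧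
    ∀ t : PBT, t.coords.length = n →
      ((∃ ε : ℕ → ℝ, CubeEps n ε ∧ PBT.M n t = Mcube n ε) ↔
        ∃ k : ℕ, PBT.phi t =
          List.ofFn fun i : Fin (n - 1) => if (i : ℕ) + 1 ≤ k then (1 : ℝ) else 0) := by
  refine ⟨?_, fun t ht =>
    (PBT.exists_M_eq_Mcube_iff hn ht).trans (PBT.exists_phi_eq_iff hn ht).symm⟩
  have himage : {x : Fin n → ℝ | ∃ t : PBT, t.coords.length = n ∧ x = PBT.M n t} ∩
      {x : Fin n → ℝ | ∃ ε : ℕ → ℝ, CubeEps n ε ∧ x = Mcube n ε} =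
      commonVertex n '' (Finset.range n : Set ℕ) := by
    ext x
    constructor
    · rintro ⟨⟨t, ht, rfl⟩, hε⟩
      obtain ⟨a, ha, rfl⟩ := (PBT.exists_M_eq_Mcube_iff hn ht).1 hε
      exact ⟨a, by simpa using ha, (PBT.M_node_combs ha).symm⟩
    · rintro ⟨a, ha, rfl⟩
      have ha : a < n := by simpa using ha
      obtain ⟨ε, hε, h⟩ := exists_Mcube_eq_commonVertex n a
      refine ⟨⟨_, ?_, (PBT.M_node_combs ha).symm⟩, ε, hε, h.symm⟩
      rw [PBT.length_coords_node, PBT.length_coords_leftComb, PBT.length_coords_rightComb]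
      omega
  rw [himage, (commonVertex_injOn n).ncard_image, Set.ncard_coe_finset,
    Finset.card_range]
end
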